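/- arXiv:1907.11675 — 4 statements merged into one kernel-verified Lean document; each statement's English description precedes it below -/
import Mathlib

section
/- Let $R$ be a commutative integral domain graded by $\mathbb{Z}^r$, fix a finite family of vectors $v_\rho \in \mathbb{Z}^r$ ($\rho \in P$, $P$ finite), and for nonzero $f \in R$ define $\phi_f(n) = \min_{\chi \in \operatorname{supp}(f)} \langle \chi, n \rangle$ and $\Delta_f = \{ u \in \mathbb{Q}^r \mid \langle u, v_\rho \rangle \leq \phi_f(v_\rho) \ \forall \rho \in P \}$. Let $S \subseteq R \setminus \{0\}$ be a nonempty subset closed under multiplication such that $\Delta_f \neq \varnothing$ for every $f \in S$, and let $L \subseteq \mathbb{Q}^r$ be the linear subspace spanned by $\{ a - b \mid a, b \in \Delta_f, \ f \in S \}$. Then there exists a single element $e \in S$ such that $L$ equals the linear subspace spanned by $\{ a - b \mid a, b \in \Delta_e \}$. -/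
/-- The support of `f` in a `ℤ^r`-graded ring. -/
def gradedSupp {R : Type*} [CommRing R] {r : ℕ}
    (𝒜 : (Fin r → ℤ) → AddSubgroup R) [GradedRing 𝒜] (f : R) : Set (Fin r → ℤ) :=
  {χ | DirectSum.decompose 𝒜 f χ ≠ 0}

/-- `φ_f(n) = min_{χ ∈ supp f} ⟨χ, n⟩`. -/
noncomputable def gradedPhi {R : Type*} [CommRing R] {r : ℕ}
    (𝒜 : (Fin r → ℤ) → AddSubgroup R) [GradedRing 𝒜] (f : R) (n : Fin r → ℤ) : ℤ :=
  sInf ((fun χ => ∑ j, χ j * n j) '' gradedSupp 𝒜 f)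

/-- The polyhedron `Δ_f = { u ∈ ℚ^r | ⟨u, v_ρ⟩ ≤ φ_f(v_ρ) for all ρ ∈ P }`. -/
noncomputable def gradedDelta {R : Type*} [CommRing R] {r : ℕ}
    (𝒜 : (Fin r → ℤ) → AddSubgroup R) [GradedRing 𝒜] {P : Type*} [Fintype P]
    (v : P → (Fin r → ℤ)) (f : R) : Set (Fin r → ℚ) :=
  {u | ∀ ρ : P, (∑ j, u j * (v ρ j : ℚ)) ≤ (gradedPhi 𝒜 f (v ρ) : ℚ)}

theorem gradedSupp_finite {R : Type*} [CommRing R] {r : ℕ}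
    (𝒜 : (Fin r → ℤ) → AddSubgroup R) [GradedRing 𝒜] (f : R) : (gradedSupp 𝒜 f).Finite :=
  DFinsupp.finite_support (DirectSum.decompose 𝒜 f)

theorem gradedSupp_nonempty {R : Type*} [CommRing R] {r : ℕ}
    (𝒜 : (Fin r → ℤ) → AddSubgroup R) [GradedRing 𝒜] {f : R} (hf : f ≠ 0) :
    (gradedSupp 𝒜 f).Nonempty := by
  by_contra h
  refine hf ((DirectSum.decompose 𝒜).injective ?_)
  rw [DirectSum.decompose_zero]
  refine DFinsupp.ext fun χ => ?_
  by_contra hχ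
  exact h ⟨χ, hχ⟩

theorem exists_add_eq_of_mem_gradedSupp_mul {R : Type*} [CommRing R] {r : ℕ}
    (𝒜 : (Fin r → ℤ) → AddSubgroup R) [GradedRing 𝒜] {f g : R} {χ : Fin r → ℤ}
    (hχ : χ ∈ gradedSupp 𝒜 (f * g)) :
    ∃ a ∈ gradedSupp 𝒜 f, ∃ b ∈ gradedSupp 𝒜 g, a + b = χ := by
  classical
  by_contra! h
  apply hχ
  rw [← Subtype.coe_inj, DirectSum.decompose_mul, DirectSum.coe_mul_apply,
    Finset.filter_eq_empty_iff.2, Finset.sum_empty, ZeroMemClass.coe_zero]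
  rintro ⟨a, b⟩ hab
  obtain ⟨ha, hb⟩ := Finset.mem_product.1 hab
  exact h a (DFinsupp.mem_support_iff.1 ha) b (DFinsupp.mem_support_iff.1 hb)

theorem gradedPhi_le {R : Type*} [CommRing R] {r : ℕ}
    (𝒜 : (Fin r → ℤ) → AddSubgroup R) [GradedRing 𝒜] {f : R} {χ : Fin r → ℤ}
    (hχ : χ ∈ gradedSupp 𝒜 f) (n : Fin r → ℤ) : gradedPhi 𝒜 f n ≤ ∑ j, χ j * n j :=
  csInf_le ((gradedSupp_finite 𝒜 f).image _).bddBelow ⟨χ, hχ, rfl⟩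

theorem gradedPhi_add_le_gradedPhi_mul {R : Type*} [CommRing R] {r : ℕ}
    (𝒜 : (Fin r → ℤ) → AddSubgroup R) [GradedRing 𝒜] {f g : R} (hfg : f * g ≠ 0)
    (n : Fin r → ℤ) : gradedPhi 𝒜 f n + gradedPhi 𝒜 g n ≤ gradedPhi 𝒜 (f * g) n := by
  refine le_csInf ((gradedSupp_nonempty 𝒜 hfg).image _) ?_
  rintro _ ⟨χ, hχ, rfl⟩
  obtain ⟨a, ha, b, hb, rfl⟩ := exists_add_eq_of_mem_gradedSupp_mul 𝒜 hχ
  simpa only [Pi.add_apply, add_mul, Finset.sum_add_distrib] using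
    add_le_add (gradedPhi_le 𝒜 ha n) (gradedPhi_le 𝒜 hb n)

theorem add_mem_gradedDelta_mul {R : Type*} [CommRing R] {r : ℕ}
    (𝒜 : (Fin r → ℤ) → AddSubgroup R) [GradedRing 𝒜] {P : Type*} [Fintype P]
    (v : P → (Fin r → ℤ)) {f g : R} (hfg : f * g ≠ 0) {a b : Fin r → ℚ}
    (ha : a ∈ gradedDelta 𝒜 v f) (hb : b ∈ gradedDelta 𝒜 v g) :
    a + b ∈ gradedDelta 𝒜 v (f * g) := by
  intro ρ
  have h : (gradedPhi 𝒜 f (v ρ) : ℚ) + gradedPhi 𝒜 g (v ρ) ≤ gradedPhi 𝒜 (f * g) (v ρ) :=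
    mod_cast gradedPhi_add_le_gradedPhi_mul 𝒜 hfg (v ρ)
  simp only [Pi.add_apply, add_mul, Finset.sum_add_distrib]
  exact (add_le_add (ha ρ) (hb ρ)).trans h

/-- The direction space of the polyhedron `Δ_f`. -/
def gradedDeltaDirection {R : Type*} [CommRing R] {r : ℕ}
    (𝒜 : (Fin r → ℤ) → AddSubgroup R) [GradedRing 𝒜] {P : Type*} [Fintype P]
    (v : P → (Fin r → ℤ)) (f : R) : Submodule ℚ (Fin r → ℚ) :=
  Submodule.span ℚ
    {x : Fin r → ℚ | ∃ a ∈ gradedDelta 𝒜 v f, ∃ b ∈ gradedDelta 𝒜 v f, x = a - b}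

theorem gradedDeltaDirection_le_mul_right {R : Type*} [CommRing R] {r : ℕ}
    (𝒜 : (Fin r → ℤ) → AddSubgroup R) [GradedRing 𝒜] {P : Type*} [Fintype P]
    (v : P → (Fin r → ℤ)) {f g : R} (hfg : f * g ≠ 0) (hg : (gradedDelta 𝒜 v g).Nonempty) :
    gradedDeltaDirection 𝒜 v f ≤ gradedDeltaDirection 𝒜 v (f * g) := by
  obtain ⟨c, hc⟩ := hg
  refine Submodule.span_mono ?_
  rintro _ ⟨a, ha, b, hb, rfl⟩
  exact ⟨a + c, add_mem_gradedDelta_mul 𝒜 v hfg ha hc, b + c,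
    add_mem_gradedDelta_mul 𝒜 v hfg hb hc, (add_sub_add_right_eq_sub a b c).symm⟩

/-- If `S` is a nonempty multiplicatively closed set of nonzero
elements with all `Δ_f` nonempty, then the span `L` of all differences of points of
the `Δ_f`, `f ∈ S`, is achieved by a single element `e ∈ S`. -/
theorem exists_single_element_spanning_L
    {R : Type*} [CommRing R] [IsDomain R] {r : ℕ}
    (𝒜 : (Fin r → ℤ) → AddSubgroup R) [GradedRing 𝒜] {P : Type*} [Fintype P]
    (v : P → (Fin r → ℤ)) (S : Set R) (hS0 : ∀ f ∈ S, f ≠ 0) (hSne : S.Nonempty)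
    (hSmul : ∀ f ∈ S, ∀ g ∈ S, f * g ∈ S)
    (hSΔ : ∀ f ∈ S, (gradedDelta 𝒜 v f).Nonempty)
    (L : Submodule ℚ (Fin r → ℚ))
    (hL : L = Submodule.span ℚ
      {x : Fin r → ℚ | ∃ f ∈ S, ∃ a ∈ gradedDelta 𝒜 v f, ∃ b ∈ gradedDelta 𝒜 v f,
        x = a - b}) :
    ∃ e ∈ S, L = Submodule.span ℚ
      {x : Fin r → ℚ | ∃ a ∈ gradedDelta 𝒜 v e, ∃ b ∈ gradedDelta 𝒜 v e, x = a - b} := by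
  obtain ⟨_, ⟨e, he, rfl⟩, hmax⟩ := WellFounded.has_min
    (wellFounded_gt (α := Submodule ℚ (Fin r → ℚ))) (gradedDeltaDirection 𝒜 v '' S)
    (hSne.image _)
  refine ⟨e, he, hL.trans (le_antisymm (Submodule.span_le.2 ?_) (Submodule.span_mono ?_))⟩
  · rintro _ ⟨f, hf, a, ha, b, hb, rfl⟩
    have hef := hSmul e he f hf
    have hle := gradedDeltaDirection_le_mul_right 𝒜 v (hS0 _ hef) (hSΔ f hf)
    have heq : gradedDeltaDirection 𝒜 v e = gradedDeltaDirection 𝒜 v (e * f) :=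
      hle.eq_of_not_lt (hmax _ ⟨_, hef, rfl⟩)
    change a - b ∈ gradedDeltaDirection 𝒜 v e
    rw [heq, mul_comm]
    exact gradedDeltaDirection_le_mul_right 𝒜 v (hS0 _ (hSmul f hf e he)) (hSΔ e he)
      (Submodule.subset_span ⟨a, ha, b, hb, rfl⟩)
  · rintro _ ⟨a, ha, b, hb, rfl⟩
    exact ⟨e, he, a, ha, b, hb, rfl⟩
end

section
/- Let $\Delta \subseteq \mathbb{R}^r$ be the convex hull of a finite set of points of $\mathbb{Q}^r$, and let $m$ be the dimension of the linear subspace of $\mathbb{R}^r$ spanned by $\{ a - b \mid a, b \in \Delta \}$. Then there exists a constant $C > 0$ such that for every positive integer $l$, the number of lattice points in the dilated polytope satisfies $\#\left( \mathbb{Z}^r \cap l \cdot \Delta \right) \leq C \cdot l^m$, where $l \cdot \Delta = \{ l x \mid x \in \Delta \}$. -/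
open scoped Pointwise

/-- On a subspace `V` of `ι → K`, at most `finrank K V` of the coordinates already separate
points. -/
theorem Submodule.exists_separating_coordinates {K ι : Type*} [Field K] [Finite ι]
    (V : Submodule K (ι → K)) :
    ∃ J : Set ι, Nat.card J ≤ Module.finrank K V ∧
      ∀ v ∈ V, (∀ j ∈ J, v j = 0) → v = 0 := by
  let φ : ι → Module.Dual K V := fun i => (LinearMap.proj i).comp V.subtype
  obtain ⟨κ, a, ha, hspan, hli⟩ := exists_linearIndependent' K φ
  have : Finite κ := Finite.of_injective a ha
  have : Fintype κ := Fintype.ofFinite κ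
  refine ⟨Set.range a, ?_, fun v hv h => ?_⟩
  · rw [Nat.card_range_of_injective ha, Nat.card_eq_fintype_card, ← Subspace.dual_finrank_eq]
    exact hli.fintype_card_le_finrank
  · have key : Submodule.span K (Set.range (φ ∘ a)) ≤
        LinearMap.ker (Module.Dual.eval K V ⟨v, hv⟩) := by
      rw [Submodule.span_le]
      rintro _ ⟨k, rfl⟩
      exact h (a k) ⟨k, rfl⟩
    rw [hspan] at key
    funext i
    exact key (Submodule.subset_span ⟨i, rfl⟩)

/-- If the coordinates in `J` separate the points of `S` and are bounded by `N` in absolute value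
on `S`, then `S` has at most `(2 * N + 1) ^ #J` integral points. -/
theorem Nat.card_integral_points_le {ι : Type*} (S : Set (ι → ℝ)) (J : Set ι) [Finite J] (N : ℕ)
    (hS : ∀ x ∈ S, ∀ j, |x j| ≤ N)
    (hJ : ∀ x ∈ S, ∀ y ∈ S, (∀ j ∈ J, x j = y j) → x = y) :
    Nat.card {x : ι → ℝ | (∀ j, ∃ z : ℤ, x j = (z : ℝ)) ∧ x ∈ S} ≤ (2 * N + 1) ^ Nat.card J := by
  let f : {x : ι → ℝ | (∀ j, ∃ z : ℤ, x j = (z : ℝ)) ∧ x ∈ S} → J → Set.Icc (-N : ℤ) N :=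
    fun x j => ⟨⌊x.1 j⌋, by
      obtain ⟨z, hz⟩ := x.2.1 j
      have h := hS x.1 x.2.2 j
      rw [hz] at h ⊢
      rw [Int.floor_intCast]
      exact abs_le.mp (by exact_mod_cast h)⟩
  have hf : Function.Injective f := by
    rintro ⟨x, hx, hxS⟩ ⟨y, hy, hyS⟩ hxy
    refine Subtype.ext (hJ x hxS y hyS fun j hj => ?_)
    have h : ⌊x j⌋ = ⌊y j⌋ := congrArg Subtype.val (congrFun hxy ⟨j, hj⟩)
    obtain ⟨z, hz⟩ := hx j
    obtain ⟨w, hw⟩ := hy j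
    rw [hz, hw, Int.floor_intCast, Int.floor_intCast] at h
    rw [hz, hw, h]
  refine (Nat.card_le_card_of_injective f hf).trans_eq ?_
  have hcard : Nat.card (Set.Icc (-N : ℤ) N) = 2 * N + 1 := by
    rw [Nat.card_eq_fintype_card, Fintype.card_ofFinset, Int.card_Icc]
    omega
  rw [Nat.card_fun, hcard]

/-- For a rational polytope `Δ ⊆ ℝ^r` whose span of differences has
dimension `m`, the number of lattice points of `l • Δ` is at most `C * l^m`. -/
theorem lattice_points_of_dilated_polytope_upper_bound {r m : ℕ}
    (F : Finset (Fin r → ℚ)) (Δ : Set (Fin r → ℝ))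
    (hΔ : Δ = convexHull ℝ
      ((fun (u : Fin r → ℚ) (j : Fin r) => ((u j : ℚ) : ℝ)) '' (F : Set (Fin r → ℚ))))
    (hm : Module.finrank ℝ
      (Submodule.span ℝ {x : Fin r → ℝ | ∃ a ∈ Δ, ∃ b ∈ Δ, x = a - b}) = m) :
    ∃ C : ℝ, 0 < C ∧ ∀ l : ℕ, 0 < l →
      (Nat.card {x : Fin r → ℝ |
        (∀ j, ∃ z : ℤ, x j = (z : ℝ)) ∧ x ∈ (l : ℝ) • Δ} : ℝ) ≤ C * (l : ℝ) ^ m := by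
  have hbdd : Bornology.IsBounded Δ := by
    rw [hΔ, isBounded_convexHull]
    exact (F.finite_toSet.image _).isBounded
  obtain ⟨R, hR⟩ := hbdd.exists_norm_le
  obtain ⟨N, hN⟩ := exists_nat_ge R
  obtain ⟨J, hJcard, hJ⟩ := Submodule.exists_separating_coordinates
    (Submodule.span ℝ {x : Fin r → ℝ | ∃ a ∈ Δ, ∃ b ∈ Δ, x = a - b})
  rw [hm] at hJcard
  refine ⟨(2 * N + 1) ^ m, by positivity, fun l hl => ?_⟩
  have hcount := Nat.card_integral_points_le ((l : ℝ) • Δ) J (l * N) ?_ ?_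
  · have hbase : 2 * (l * N) + 1 ≤ (2 * N + 1) * l := by nlinarith
    have h := calc
      _ ≤ _ := hcount
      _ ≤ (2 * (l * N) + 1) ^ m := Nat.pow_le_pow_right (by omega) hJcard
      _ ≤ ((2 * N + 1) * l) ^ m := Nat.pow_le_pow_left hbase m
      _ = (2 * N + 1) ^ m * l ^ m := mul_pow _ _ _
    exact_mod_cast h
  · rintro _ ⟨x, hx, rfl⟩ j
    have h : |x j| ≤ N := (norm_le_pi_norm x j).trans ((hR x hx).trans hN)
    simp only [Pi.smul_apply, smul_eq_mul, abs_mul, Nat.abs_cast, Nat.cast_mul]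
    gcongr
  · rintro _ ⟨x, hx, rfl⟩ _ ⟨y, hy, rfl⟩ hxy
    have hl' : (l : ℝ) ≠ 0 := by positivity
    have h := hJ (x - y) (Submodule.subset_span ⟨x, hx, y, hy, rfl⟩) fun j hj =>
      sub_eq_zero.mpr (mul_left_cancel₀ hl' (hxy j hj))
    rw [sub_eq_zero.mp h]
end

section
/- Let $K_1, \ldots, K_q \subseteq \mathbb{R}^m$ be nonempty compact convex sets such that the Minkowski sum $K_1 + \cdots + K_q$ has nonempty interior. Then there exists a positive integer $N$ such that the intersection $\bigcap_{c} \left( (1+c_1) \cdot K_1 + \cdots + (1+c_q) \cdot K_q \right)$, taken over all $c = (c_1,\ldots,c_q) \in \mathbb{R}^q$ with $\max_i |c_i| \leq 1/N$, has nonempty interior in $\mathbb{R}^m$. -/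
open scoped Pointwise

/-- If compact convex nonempty sets `K_1, …, K_q ⊆ ℝ^m` have a
Minkowski sum with nonempty interior, then for some positive integer `N` the
intersection of all perturbed sums `(1+c_1) • K_1 + ⋯ + (1+c_q) • K_q` over
`max_i |c_i| ≤ 1/N` still has nonempty interior. -/
theorem perturbed_minkowski_sum_interior_nonempty {m q : ℕ}
    (K : Fin q → Set (EuclideanSpace ℝ (Fin m)))
    (hne : ∀ i, (K i).Nonempty) (hcomp : ∀ i, IsCompact (K i))
    (hconv : ∀ i, Convex ℝ (K i))
    (hint : (interior (∑ i : Fin q, K i)).Nonempty) :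
    ∃ N : ℕ, 0 < N ∧
      (interior (⋂ c ∈ {c : Fin q → ℝ | ∀ i, |c i| ≤ 1 / (N : ℝ)},
        ∑ i : Fin q, (1 + c i) • K i)).Nonempty := by
  choose k hk using hne
  obtain ⟨x, hx⟩ := hint
  obtain ⟨r, hr, hball⟩ := Metric.isOpen_iff.1 isOpen_interior x hx
  have hball' := hball.trans interior_subset
  set M : ℝ := ‖x‖ + 2 * ∑ i, ‖k i‖ + r with hM
  have hM0 : 0 < M := by positivity
  obtain ⟨N, hN⟩ := exists_nat_gt (2 * M / r + 1)
  have hN1 : (1 : ℝ) < N := by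
    have : 0 < 2 * M / r := by positivity
    linarith
  have hN0 : (0 : ℝ) < N := by linarith
  refine ⟨N, by exact_mod_cast hN0, x, ?_⟩
  rw [mem_interior]
  refine ⟨Metric.ball x (r / 2), ?_, Metric.isOpen_ball, Metric.mem_ball_self (by positivity)⟩
  intro y hy
  rw [Metric.mem_ball, dist_eq_norm] at hy
  simp only [Set.mem_iInter]
  intro c hc
  rw [Set.mem_ofPred_eq] at hc
  set δ : ℝ := 1 / (N : ℝ) with hδ
  have hδ0 : 0 < δ := by positivity
  have hδ1 : δ < 1 := by rw [hδ, div_lt_one hN0]; exact hN1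
  have hδM : δ * M < r / 2 := by
    have h : 2 * M / r < N := by linarith
    rw [div_lt_iff₀ hr] at h
    rw [hδ, one_div, inv_mul_lt_iff₀ hN0]
    linarith
  have h1δ : 0 < 1 - δ := by linarith
  have hcnonneg : ∀ i, 0 ≤ δ + c i := fun i => by linarith [(abs_le.1 (hc i)).1]
  have hsum : ‖∑ i, (δ + c i) • k i‖ ≤ δ * (2 * ∑ i, ‖k i‖) := by
    rw [← mul_assoc, Finset.mul_sum]
    refine norm_sum_le_of_le _ fun i _ => ?_
    rw [norm_smul, Real.norm_of_nonneg (hcnonneg i)]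
    gcongr
    linarith [(abs_le.1 (hc i)).2]
  have hz : (1 - δ)⁻¹ • (y - ∑ i, (δ + c i) • k i) ∈ ∑ i, K i := by
    apply hball'
    have heq : (1 - δ)⁻¹ • (y - ∑ i, (δ + c i) • k i) - x
        = (1 - δ)⁻¹ • ((y - x) + δ • x - ∑ i, (δ + c i) • k i) := by
      rw [← sub_eq_zero]
      match_scalars <;> field_simp <;> ring
    rw [Metric.mem_ball, dist_eq_norm, heq, norm_smul,
      Real.norm_of_nonneg (inv_nonneg.2 h1δ.le), inv_mul_lt_iff₀ h1δ]
    have hδx : ‖δ • x‖ = δ * ‖x‖ := by rw [norm_smul, Real.norm_of_nonneg hδ0.le]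
    have h1 := norm_sub_le ((y - x) + δ • x) (∑ i, (δ + c i) • k i)
    have h2 := norm_add_le (y - x) (δ • x)
    rw [hM] at hδM
    linarith
  rw [Set.mem_fintype_sum] at hz ⊢
  obtain ⟨s, hs, hsz⟩ := hz
  refine ⟨fun i => (1 - δ) • s i + (δ + c i) • k i, fun i => ?_, ?_⟩
  · rw [show 1 + c i = (1 - δ) + (δ + c i) by ring, (hconv i).add_smul h1δ.le (hcnonneg i)]
    exact Set.add_mem_add (Set.smul_mem_smul_set (hs i)) (Set.smul_mem_smul_set (hk i))
  · rw [Finset.sum_add_distrib, ← Finset.smul_sum, hsz, smul_inv_smul₀ h1δ.ne', sub_add_cancel]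
end

section
/- Let $K_1, \ldots, K_q \subseteq \mathbb{R}^m$ be nonempty sets, let $N$ be a positive integer, and suppose there exist $x \in \mathbb{R}^m$ and $s > 0$ such that the closed ball of center $x$ and radius $s$ is contained in $(1+c_1) \cdot K_1 + \cdots + (1+c_q) \cdot K_q$ for every $c = (c_1,\ldots,c_q) \in \mathbb{R}^q$ with $\max_i |c_i| \leq 1/N$. Then for every positive integer $l$ and all nonnegative integers $c_1, \ldots, c_q$ with $c_1 + \cdots + c_q = l$, the closed ball of center $l N x$ and radius $l N s$ is contained in $(lN + c_1) \cdot K_1 + \cdots + (lN + c_q) \cdot K_q$. -/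
open scoped Pointwise

/-- If the closed ball `B(x, s)` is contained in every perturbed sum
`(1+c_1) • K_1 + ⋯ + (1+c_q) • K_q` with `max_i |c_i| ≤ 1/N`, then for every `l > 0`
and nonnegative integers `c_i` with `∑ c_i = l`, the ball `B(lN • x, lN s)` is
contained in `(lN + c_1) • K_1 + ⋯ + (lN + c_q) • K_q`. -/
theorem ball_subset_scaled_minkowski_sum {m q : ℕ}
    (K : Fin q → Set (EuclideanSpace ℝ (Fin m))) (hne : ∀ i, (K i).Nonempty)
    (N : ℕ) (hN : 0 < N) (x : EuclideanSpace ℝ (Fin m)) (s : ℝ) (hs : 0 < s)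
    (hball : ∀ c : Fin q → ℝ, (∀ i, |c i| ≤ 1 / (N : ℝ)) →
      Metric.closedBall x s ⊆ ∑ i : Fin q, (1 + c i) • K i) :
    ∀ l : ℕ, 0 < l → ∀ c : Fin q → ℕ, (∑ i, c i) = l →
      Metric.closedBall (((l * N : ℕ) : ℝ) • x) (((l * N : ℕ) : ℝ) * s) ⊆
        ∑ i : Fin q, (((l * N + c i : ℕ) : ℝ)) • K i := by
  intro l hl c hc
  have hNR : (0 : ℝ) < N := by exact_mod_cast hN
  have hlR : (0 : ℝ) < l := by exact_mod_cast hl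
  have hlN : (0 : ℝ) < ((l * N : ℕ) : ℝ) := by exact_mod_cast Nat.mul_pos hl hN
  have hcl : ∀ i, |(c i : ℝ) / ((l * N : ℕ) : ℝ)| ≤ 1 / (N : ℝ) := fun i => by
    have hi : (c i : ℝ) ≤ l := by
      exact_mod_cast hc ▸ Finset.single_le_sum (fun j _ => Nat.zero_le (c j)) (Finset.mem_univ i)
    rw [abs_of_nonneg (by positivity), div_le_div_iff₀ hlN hNR]
    push_cast
    nlinarith
  have hscaled := Set.smul_set_mono (a := ((l * N : ℕ) : ℝ)) (hball _ hcl)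
  rw [smul_closedBall' hlN.ne', Real.norm_of_nonneg hlN.le, Finset.smul_sum] at hscaled
  refine hscaled.trans_eq (Finset.sum_congr rfl fun i _ => ?_)
  rw [smul_smul, mul_add, mul_one, mul_div_cancel₀ _ hlN.ne', ← Nat.cast_add]
end
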